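/- Let L: (ℓ^p)^m → ℝ be a continuous symmetric m-linear map with associated polynomial L̂, where p ≥ m ≥ 1. If x_1, ..., x_n are norm-one vectors in ℓ^p with pairwise disjoint supports and k_1,...,k_n are nonnegative integers summing to m, then |L(x_1^{k_1} ⋯ x_n^{k_n})| ≤ (p 2^{p/2} Γ(p/2) m^{p/2} / m!) · ‖L̂‖. -/

import Mathlib

open ENNReal

def sg (b : Bool) : ℝ := if b then 1 else -1

lemma sum_prod_sg {m : ℕ} (f : Fin m → Bool → ℝ) :
    ∑ e : Fin m → Bool, ∏ i, f i (e i) = ∏ i, (f i true + f i false) := by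
  have := Finset.prod_univ_sum (fun _ : Fin m => (Finset.univ : Finset Bool)) f
  rw [Fintype.piFinset_univ] at this
  rw [← this]
  simp

lemma sg_orth {m : ℕ} (r : Fin m → Fin m) (hr : ¬ Function.Bijective r) :
    ∑ e : Fin m → Bool, (∏ i, sg (e i)) * ∏ i, sg (e (r i)) = 0 := by
  have h1 : ∀ e : Fin m → Bool, (∏ i, sg (e i)) * ∏ i, sg (e (r i)) =
      ∏ l, (sg (e l) * sg (e l) ^ (Finset.univ.filter fun i => r i = l).card) := by
    intro e
    rw [Finset.prod_mul_distrib]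
    congr 1
    rw [← Finset.prod_fiberwise Finset.univ r]
    refine Finset.prod_congr rfl fun l _ => ?_
    rw [← Finset.prod_const]
    refine Finset.prod_congr rfl fun i hi => ?_
    rw [(Finset.mem_filter.1 hi).2]
  simp_rw [h1]
  rw [sum_prod_sg (fun l b => sg b * sg b ^ (Finset.univ.filter fun i => r i = l).card)]
  have hs : ¬ Function.Surjective r := fun h => hr (Finite.surjective_iff_bijective.1 h)
  simp only [Function.Surjective, not_forall, not_exists] at hs
  obtain ⟨l, hl⟩ := hs
  refine Finset.prod_eq_zero (Finset.mem_univ l) ?_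
  simp [hl, sg]

lemma sg_sq (b : Bool) : sg b * sg b = 1 := by cases b <;> simp [sg]

lemma abs_sg (b : Bool) : |sg b| = 1 := by cases b <;> simp [sg]

lemma sg_perm {m : ℕ} (r : Fin m → Fin m) (hr : Function.Bijective r) :
    ∑ e : Fin m → Bool, (∏ i, sg (e i)) * ∏ i, sg (e (r i)) = 2 ^ m := by
  have : ∀ e : Fin m → Bool, (∏ i, sg (e i)) * ∏ i, sg (e (r i)) = 1 := by
    intro e
    rw [hr.prod_comp (fun i => sg (e i)), ← Finset.prod_mul_distrib]
    simp [sg_sq]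
  simp [this]

lemma polar {E : Type*} [NormedAddCommGroup E] [NormedSpace ℝ E] {m : ℕ}
    (L : ContinuousMultilinearMap ℝ (fun _ : Fin m => E) ℝ)
    (hsymm : ∀ (σ : Equiv.Perm (Fin m)) (v : Fin m → E), L (fun i => v (σ i)) = L v)
    (v : Fin m → E) :
    ∑ e : Fin m → Bool, (∏ i, sg (e i)) * L (fun _ => ∑ i, sg (e i) • v i) =
      2 ^ m * m.factorial * L v := by
  have h1 : ∀ e : Fin m → Bool, L (fun _ => ∑ i, sg (e i) • v i) =
      ∑ r : Fin m → Fin m, (∏ i, sg (e (r i))) * L (fun i => v (r i)) := by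
    intro e
    rw [L.map_sum (fun _ i => sg (e i) • v i)]
    refine Finset.sum_congr rfl fun r _ => ?_
    exact L.map_smul_univ (fun i => sg (e (r i))) (fun i => v (r i))
  simp_rw [h1, Finset.mul_sum]
  rw [Finset.sum_comm]
  simp_rw [← mul_assoc, ← Finset.sum_mul]
  classical
  have h2 : ∀ r : Fin m → Fin m, (∑ e : Fin m → Bool, (∏ i, sg (e i)) * ∏ i, sg (e (r i))) *
      L (fun i => v (r i)) = if Function.Bijective r then 2 ^ m * L v else 0 := by
    intro r
    split_ifs with h
    · rw [sg_perm r h, ← hsymm (Equiv.ofBijective r h) v]; rfl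
    · rw [sg_orth r h, zero_mul]
  simp_rw [h2]
  rw [← Finset.sum_filter, Finset.sum_const, nsmul_eq_mul]
  have : (Finset.univ.filter fun r : Fin m → Fin m => Function.Bijective r).card = m.factorial := by
    rw [← Fintype.card_subtype, Fintype.card_congr (Equiv.subtypeEquivRight (p := fun r : Fin m → Fin m => Function.Bijective r) (q := fun r => Function.Bijective r) (fun _ => Iff.rfl)),
      ← Fintype.card_congr (Equiv.ofBijective (fun σ : Equiv.Perm (Fin m) => (⟨σ, σ.bijective⟩ : {r : Fin m → Fin m // Function.Bijective r})) ⟨fun a b h => Equiv.coe_fn_injective (congrArg Subtype.val h), fun r => ⟨Equiv.ofBijective r.1 r.2, rfl⟩⟩), Fintype.card_perm, Fintype.card_fin]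
  rw [this]; ring

-- Hoeffding
lemma mgf {m : ℕ} (A : Finset (Fin m)) (l : ℝ) :
    ∑ e : Fin m → Bool, Real.exp (l * ∑ i ∈ A, sg (e i)) ≤ 2 ^ m * Real.exp (A.card * l ^ 2 / 2) := by
  have h1 : ∀ e : Fin m → Bool, Real.exp (l * ∑ i ∈ A, sg (e i)) =
      ∏ i, (if i ∈ A then Real.exp (l * sg (e i)) else 1) := by
    intro e
    rw [Finset.mul_sum, Real.exp_sum, Finset.prod_ite_mem, Finset.univ_inter]
  simp_rw [h1]
  rw [sum_prod_sg (fun i b => if i ∈ A then Real.exp (l * sg b) else 1)]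
  have h2 : ∀ i : Fin m, ((if i ∈ A then Real.exp (l * sg true) else 1) + (if i ∈ A then Real.exp (l * sg false) else 1)) = 2 * (if i ∈ A then Real.cosh l else 1) := by
    intro i
    split_ifs
    · rw [Real.cosh_eq]; simp [sg]; ring
    · norm_num
  simp_rw [h2]
  rw [Finset.prod_mul_distrib, Finset.prod_ite_mem, Finset.univ_inter]
  simp only [Finset.prod_const, Finset.card_univ, Fintype.card_fin]
  gcongr
  calc Real.cosh l ^ A.card ≤ Real.exp (l ^ 2 / 2) ^ A.card := by
        gcongr
        exact Real.cosh_le_exp_half_sq l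
    _ = _ := by rw [← Real.exp_nat_mul]; ring_nf

lemma tail {m : ℕ} (A : Finset (Fin m)) (hA : 0 < A.card) (t : ℝ) (ht : 0 < t) :
    ∑ e : Fin m → Bool, (if t < |∑ i ∈ A, sg (e i)| then (1:ℝ) else 0) ≤
      2 ^ m * (2 * Real.exp (-(1 / (2 * A.card)) * t ^ 2)) := by
  set k : ℝ := (A.card : ℝ) with hk
  have hk0 : 0 < k := by rw [hk]; exact_mod_cast hA
  have h : ∀ e : Fin m → Bool, (if t < |∑ i ∈ A, sg (e i)| then (1:ℝ) else 0) ≤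
      Real.exp (-(t^2 / k)) * (Real.exp ((t / k) * ∑ i ∈ A, sg (e i)) +
        Real.exp ((-(t / k)) * ∑ i ∈ A, sg (e i))) := by
    intro e
    set c := ∑ i ∈ A, sg (e i)
    split_ifs with h
    · rw [mul_add, ← Real.exp_add, ← Real.exp_add]
      have hd : 0 < t / k := by positivity
      have e1 : t^2/k = t / k * t := by ring
      rcases lt_abs.1 h with h | h
      · have : (1:ℝ) ≤ Real.exp (-(t^2/k) + t/k * c) := by
          rw [Real.one_le_exp_iff, e1]; nlinarith
        linarith [Real.exp_pos (-(t ^ 2 / k) + -(t / k) * c)]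
      · have : (1:ℝ) ≤ Real.exp (-(t^2/k) + -(t/k) * c) := by
          rw [Real.one_le_exp_iff, e1]; nlinarith
        linarith [Real.exp_pos (-(t ^ 2 / k) + (t / k) * c)]
    · positivity
  refine (Finset.sum_le_sum fun e _ => h e).trans ?_
  rw [← Finset.mul_sum, Finset.sum_add_distrib]
  have m1 := mgf A (t / k)
  have m2 := mgf A (-(t / k))
  rw [← hk] at m1 m2
  calc _ ≤ Real.exp (-(t^2 / k)) * (2 ^ m * Real.exp (k * (t / k) ^ 2 / 2) + 2 ^ m * Real.exp (k * (-(t / k)) ^ 2 / 2)) := by gcongr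
    _ = 2 ^ m * (2 * (Real.exp (-(t^2 / k)) * Real.exp (k * (t / k) ^ 2 / 2))) := by
        rw [neg_sq]; ring
    _ = _ := by
        rw [← Real.exp_add]; congr 3; field_simp; ring

lemma layer (q : ℝ) (hq : 1 ≤ q) (a : ℝ) (ha : 0 ≤ a) :
    MeasureTheory.IntegrableOn (fun t : ℝ => q * t ^ (q - 1) * (if t < a then (1:ℝ) else 0)) (Set.Ioi 0) ∧
    ∫ t in Set.Ioi (0:ℝ), q * t ^ (q - 1) * (if t < a then (1:ℝ) else 0) = a ^ q := by
  have hfun : (fun t : ℝ => q * t ^ (q - 1) * (if t < a then (1:ℝ) else 0)) =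
      (Set.Iio a).indicator (fun t => q * t ^ (q - 1)) := by
    ext t; simp [Set.indicator]
  have hi : IntervalIntegrable (fun t : ℝ => q * t ^ (q - 1)) MeasureTheory.volume 0 a :=
    (intervalIntegral.intervalIntegrable_rpow' (by linarith)).const_mul q
  rw [hfun]
  constructor
  · rw [MeasureTheory.IntegrableOn, MeasureTheory.integrable_indicator_iff measurableSet_Iio,
      MeasureTheory.IntegrableOn, MeasureTheory.Measure.restrict_restrict measurableSet_Iio,
      Set.inter_comm, Set.Ioi_inter_Iio]
    exact ((intervalIntegrable_iff_integrableOn_Ioo_of_le ha).1 hi)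
  · rw [MeasureTheory.integral_indicator measurableSet_Iio, MeasureTheory.Measure.restrict_restrict measurableSet_Iio,
      Set.inter_comm, Set.Ioi_inter_Iio, ← MeasureTheory.integral_Ioc_eq_integral_Ioo,
      ← intervalIntegral.integral_of_le ha, intervalIntegral.integral_const_mul, integral_rpow (Or.inl (by linarith))]
    rw [sub_add_cancel, Real.zero_rpow (by linarith)]
    field_simp; ring

lemma moment {m : ℕ} (A : Finset (Fin m)) (q : ℝ) (hq : 1 ≤ q) :
    ∑ e : Fin m → Bool, |∑ i ∈ A, sg (e i)| ^ q ≤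
      2 ^ m * (q * 2 ^ (q / 2) * Real.Gamma (q / 2) * (A.card : ℝ) ^ (q / 2)) := by
  rcases Nat.eq_zero_or_pos A.card with h0 | hA
  · rw [Finset.card_eq_zero] at h0
    subst h0
    simp [Real.zero_rpow (show q ≠ 0 by linarith), Real.zero_rpow (show q / 2 ≠ 0 by linarith)]
  have hk0 : (0:ℝ) < A.card := by exact_mod_cast hA
  have hb : (0:ℝ) < 1 / (2 * A.card) := by positivity
  have hint := integrableOn_rpow_mul_exp_neg_mul_sq hb (s := q - 1) (by linarith)
  calc ∑ e : Fin m → Bool, |∑ i ∈ A, sg (e i)| ^ q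
      = ∑ e : Fin m → Bool, ∫ t in Set.Ioi (0:ℝ), q * t ^ (q - 1) * (if t < |∑ i ∈ A, sg (e i)| then (1:ℝ) else 0) :=
        Finset.sum_congr rfl fun e _ => (layer q hq _ (abs_nonneg _)).2.symm
    _ = ∫ t in Set.Ioi (0:ℝ), ∑ e : Fin m → Bool, q * t ^ (q - 1) * (if t < |∑ i ∈ A, sg (e i)| then (1:ℝ) else 0) :=
        (MeasureTheory.integral_finsetSum _ fun e _ => (layer q hq _ (abs_nonneg _)).1).symm
    _ ≤ ∫ t in Set.Ioi (0:ℝ), (2 ^ m * q * 2) * (t ^ (q - 1) * Real.exp (-(1 / (2 * A.card)) * t ^ 2)) := by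
        refine MeasureTheory.setIntegral_mono_on (MeasureTheory.integrable_finsetSum _ fun e _ => (layer q hq _ (abs_nonneg _)).1) (hint.const_mul _) measurableSet_Ioi fun t ht => ?_
        have ht : 0 < t := ht
        rw [← Finset.mul_sum]
        calc _ ≤ q * t ^ (q-1) * (2 ^ m * (2 * Real.exp (-(1 / (2 * A.card)) * t ^ 2))) := by
              gcongr
              exact tail A hA t ht
          _ = _ := by ring
    _ = _ := by
        rw [MeasureTheory.integral_const_mul]
        have := integral_rpow_mul_exp_neg_mul_rpow (p := 2) (q := q - 1) (b := 1 / (2 * (A.card:ℝ))) (by norm_num) (by linarith) hb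
        simp only [Real.rpow_two] at this
        rw [this, sub_add_cancel, one_div, Real.inv_rpow (by positivity), neg_div, Real.rpow_neg (by positivity), inv_inv, Real.mul_rpow (by norm_num) hk0.le]
        ring

lemma norm_disj (p : ℝ≥0∞) [Fact (1 ≤ p)] (hp : p ≠ ∞) {n : ℕ} 
    (x : Fin n → lp (fun _ : ℕ => ℝ) p) (hx : ∀ j, ‖x j‖ = 1)
    (hdisj : ∀ j j', j ≠ j' → ∀ t : ℕ, x j t = 0 ∨ x j' t = 0) (c : Fin n → ℝ) :
    ‖∑ j, c j • x j‖ ^ p.toReal = ∑ j, |c j| ^ p.toReal := by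
  have hp1 : 1 ≤ p := Fact.out
  have hq : 0 < p.toReal := ENNReal.toReal_pos (by positivity) hp
  have h1 := lp.hasSum_norm hq (∑ j, c j • x j)
  have h2 : HasSum (fun t => ∑ j, |c j| ^ p.toReal * ‖x j t‖ ^ p.toReal) (∑ j, |c j| ^ p.toReal * ‖x j‖ ^ p.toReal) :=
    hasSum_sum fun j _ => (lp.hasSum_norm hq (x j)).mul_left _
  simp only [hx, Real.one_rpow, mul_one] at h2
  refine h1.unique ?_
  convert h2 using 2 with t
  have hc : (∑ j, c j • x j : lp (fun _ : ℕ => ℝ) p) t = ∑ j, c j * x j t := by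
    simp only [lp.coeFn_sum, lp.coeFn_smul]
    exact Finset.sum_apply t Finset.univ (fun j => (c j • (fun s => x j s : ℕ → ℝ) : ℕ → ℝ))
  rw [hc]
  by_cases h : ∃ j, x j t ≠ 0
  · obtain ⟨j, hj⟩ := h
    have h0 : ∀ j', j' ≠ j → x j' t = 0 := fun j' hj' => (hdisj j' j hj' t).resolve_right hj
    rw [Finset.sum_eq_single j (fun j' _ hj' => by rw [h0 j' hj', mul_zero]) (by simp),
      Finset.sum_eq_single j (fun j' _ hj' => by rw [h0 j' hj', norm_zero, Real.zero_rpow hq.ne', mul_zero]) (by simp),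
      norm_mul, Real.mul_rpow (norm_nonneg _) (norm_nonneg _), Real.norm_eq_abs]
  · push Not at h
    simp [h, Real.zero_rpow hq.ne']

lemma sg_int {m : ℕ} (A : Finset (Fin m)) (e : Fin m → Bool) :
    ∑ i ∈ A, sg (e i) = 0 ∨ 1 ≤ |∑ i ∈ A, sg (e i)| := by
  have : ∑ i ∈ A, sg (e i) = ((∑ i ∈ A, (if e i then 1 else -1) : ℤ) : ℝ) := by
    push_cast
    exact Finset.sum_congr rfl fun i _ => by simp [sg]
  rw [this]
  by_cases h : (∑ i ∈ A, (if e i then 1 else -1) : ℤ) = 0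
  · left; exact_mod_cast h
  · right; exact_mod_cast Int.one_le_abs h

lemma npow_le_aux (N q : ℝ) (m : ℕ) (hm : 1 ≤ m) (hq : (m:ℝ) ≤ q) (hN : 0 ≤ N)
    (h : N ^ q = 0 ∨ 1 ≤ N ^ q) : N ^ m ≤ N ^ q := by
  have hm' : (1:ℝ) ≤ m := by exact_mod_cast hm
  have hq0 : 0 < q := by linarith
  rcases h with h | h
  · rw [Real.rpow_eq_zero hN hq0.ne'] at h
    rw [h, Real.zero_rpow hq0.ne', zero_pow (by omega)]
  · have : 1 ≤ N := by
      by_contra hlt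
      exact absurd h (not_le.2 (Real.rpow_lt_one hN (not_le.1 hlt) hq0))
    rw [← Real.rpow_natCast]
    exact Real.rpow_le_rpow_of_exponent_le this hq

lemma sum_rpow_card (q : ℝ) (m n : ℕ) (hm : 1 ≤ m) (hq : (m:ℝ) ≤ q) (k : Fin n → ℕ)
    (hsum : ∑ j, k j = m) : ∑ j, (k j : ℝ) ^ (q / 2) ≤ (m : ℝ) ^ (q / 2) := by
  have hm' : (1:ℝ) ≤ m := by exact_mod_cast hm
  have hs : ∑ j, (k j : ℝ) = m := by exact_mod_cast hsum
  have hkm : ∀ j, k j ≤ m := fun j => hsum ▸ Finset.single_le_sum (fun _ _ => Nat.zero_le _) (Finset.mem_univ j)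
  -- each term is at most `k j * m ^ (q/2 - 1)`
  have h : ∀ j, (k j : ℝ) ^ (q / 2) ≤ k j * (m : ℝ) ^ (q / 2 - 1) := by
    intro j
    rcases Nat.eq_zero_or_pos (k j) with h0 | hpos
    · rw [h0]; simp [Real.zero_rpow (show q / 2 ≠ 0 by linarith)]
    · have hp' : (0:ℝ) < k j := by exact_mod_cast hpos
      have e1 : (k j : ℝ) ^ (q / 2) = k j * (k j : ℝ) ^ (q / 2 - 1) := by
        rw [Real.rpow_sub_one hp'.ne']; field_simp
      rw [e1]
      gcongr ?_ * ?_
      rcases Nat.lt_or_ge m 2 with h2 | h2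
      · have := hkm j
        have e2 : k j = m := by omega
        rw [e2]
      · have : (2:ℝ) ≤ m := by exact_mod_cast h2
        exact Real.rpow_le_rpow hp'.le (by exact_mod_cast hkm j) (by linarith)
  calc _ ≤ ∑ j, (k j : ℝ) * (m : ℝ) ^ (q / 2 - 1) := Finset.sum_le_sum fun j _ => h j
    _ = m * (m : ℝ) ^ (q / 2 - 1) := by rw [← Finset.sum_mul, hs]
    _ = _ := by rw [Real.rpow_sub_one (by linarith)]; field_simp

/-- case `p ≥ m` of the `ℓ^p` estimate:
`|L(x₁^{k₁} ⋯ x_n^{k_n})| ≤ (p 2^{p/2} Γ(p/2) m^{p/2} / m!) ‖L̂‖`. -/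
theorem stmt_16 (p : ℝ≥0∞) [Fact (1 ≤ p)] (hp : p ≠ ∞)
    (m n : ℕ) (hm : 1 ≤ m) (hn : 0 < n) (hpm : (m : ℝ) ≤ p.toReal)
    (L : ContinuousMultilinearMap ℝ (fun _ : Fin m => lp (fun _ : ℕ => ℝ) p) ℝ)
    (hsymm : ∀ (σ : Equiv.Perm (Fin m)) (v : Fin m → lp (fun _ : ℕ => ℝ) p),
      L (fun i => v (σ i)) = L v)
    (k : Fin n → ℕ) (hsum : ∑ j, k j = m)
    (x : Fin n → lp (fun _ : ℕ => ℝ) p) (hx : ∀ j, ‖x j‖ = 1)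
    (hdisj : ∀ j j', j ≠ j' → ∀ t : ℕ, x j t = 0 ∨ x j' t = 0)
    (b : Fin m → Fin n)
    (hb : ∀ j, (Finset.univ.filter fun i => b i = j).card = k j) :
    |L (fun i => x (b i))| ≤
      p.toReal * 2 ^ (p.toReal / 2) * Real.Gamma (p.toReal / 2) *
        (m : ℝ) ^ (p.toReal / 2) / (Nat.factorial m : ℝ) *
        sSup {r : ℝ | ∃ z : lp (fun _ : ℕ => ℝ) p, ‖z‖ ≤ 1 ∧ r = |L (fun _ => z)|} := by
  classical
  set S := sSup {r : ℝ | ∃ z : lp (fun _ : ℕ => ℝ) p, ‖z‖ ≤ 1 ∧ r = |L (fun _ => z)|} with hS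
  set q := p.toReal with hqdef
  have hm' : (1:ℝ) ≤ m := by exact_mod_cast hm
  have hq1 : 1 ≤ q := hm'.trans hpm
  have hbdd : BddAbove {r : ℝ | ∃ z : lp (fun _ : ℕ => ℝ) p, ‖z‖ ≤ 1 ∧ r = |L (fun _ => z)|} := by
    refine ⟨‖L‖, ?_⟩
    rintro r ⟨z, hz, rfl⟩
    have := L.le_opNorm (fun _ => z)
    rw [Real.norm_eq_abs] at this
    refine this.trans ?_
    simp only [Finset.prod_const, Finset.card_univ, Fintype.card_fin]
    exact mul_le_of_le_one_right (norm_nonneg _) (pow_le_one₀ (norm_nonneg _) hz)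
  have hS0 : 0 ≤ S := (abs_nonneg _).trans (le_csSup hbdd ⟨0, by simp, rfl⟩)
  have hL : ∀ z : lp (fun _ : ℕ => ℝ) p, |L (fun _ => z)| ≤ ‖z‖ ^ m * S := by
    intro z
    by_cases hz : z = 0
    · subst hz
      have : L (fun _ => (0 : lp (fun _ : ℕ => ℝ) p)) = 0 :=
        L.map_coord_zero (⟨0, hm⟩ : Fin m) rfl
      rw [this, abs_zero]; positivity
    have hz' : 0 < ‖z‖ := norm_pos_iff.2 hz
    have h1 : |L (fun _ => ‖z‖⁻¹ • z)| ≤ S :=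
      le_csSup hbdd ⟨‖z‖⁻¹ • z, by rw [norm_smul, norm_inv, norm_norm, inv_mul_cancel₀ hz'.ne'], rfl⟩
    have h2 : L (fun _ => ‖z‖⁻¹ • z) = (‖z‖⁻¹) ^ m * L (fun _ => z) := by
      have := L.map_smul_univ (fun _ => ‖z‖⁻¹) (fun _ => z)
      simpa using this
    rw [h2, abs_mul, abs_of_pos (by positivity), inv_pow, inv_mul_le_iff₀ (by positivity)] at h1
    exact h1
  let A : Fin n → Finset (Fin m) := fun j => Finset.univ.filter fun i => b i = j
  have hz : ∀ e : Fin m → Bool, |L (fun _ => ∑ i, sg (e i) • x (b i))| ≤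
      (∑ j, |∑ i ∈ A j, sg (e i)| ^ q) * S := by
    intro e
    have e1 : ∑ i, sg (e i) • x (b i) = ∑ j, (∑ i ∈ A j, sg (e i)) • x j := by
      rw [← Finset.sum_fiberwise Finset.univ b]
      refine Finset.sum_congr rfl fun j _ => ?_
      rw [Finset.sum_smul]
      refine Finset.sum_congr rfl fun i hi => ?_
      rw [(Finset.mem_filter.1 hi).2]
    refine (hL _).trans (mul_le_mul_of_nonneg_right ?_ hS0)
    rw [e1]
    have hn := norm_disj p hp x hx hdisj (fun j => ∑ i ∈ A j, sg (e i))
    rw [← hqdef] at hn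
    rw [← hn]
    refine npow_le_aux _ q m hm hpm (norm_nonneg _) ?_
    rw [hn]
    by_cases h : ∀ j, ∑ i ∈ A j, sg (e i) = 0
    · left
      simp [h, Real.zero_rpow (show q ≠ 0 by linarith)]
    · right
      push Not at h
      obtain ⟨j, hj⟩ := h
      have h1 := (sg_int (A j) e).resolve_left hj
      calc (1:ℝ) ≤ |∑ i ∈ A j, sg (e i)| ^ q := Real.one_le_rpow h1 (by linarith)
        _ ≤ _ := Finset.single_le_sum (f := fun j => |∑ i ∈ A j, sg (e i)| ^ q)
          (fun _ _ => Real.rpow_nonneg (abs_nonneg _) _) (Finset.mem_univ j)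
  have hpol := polar L hsymm (fun i => x (b i))
  have hG : 0 < Real.Gamma (q / 2) := Real.Gamma_pos_of_pos (by linarith)
  have key : 2 ^ m * (m.factorial * |L (fun i => x (b i))|) ≤
      2 ^ m * (q * 2 ^ (q / 2) * Real.Gamma (q / 2) * (m : ℝ) ^ (q / 2) * S) := by
    calc 2 ^ m * (m.factorial * |L (fun i => x (b i))|)
        = |2 ^ m * m.factorial * L (fun i => x (b i))| := by
          rw [abs_mul, abs_of_pos (by positivity : (0:ℝ) < 2 ^ m * m.factorial), mul_assoc]
      _ ≤ ∑ e : Fin m → Bool, |L (fun _ => ∑ i, sg (e i) • x (b i))| := by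
          rw [← hpol]
          refine (Finset.abs_sum_le_sum_abs _ _).trans (Finset.sum_le_sum fun e _ => ?_)
          rw [abs_mul, Finset.abs_prod]
          simp [abs_sg]
      _ ≤ ∑ e : Fin m → Bool, (∑ j, |∑ i ∈ A j, sg (e i)| ^ q) * S :=
          Finset.sum_le_sum fun e _ => hz e
      _ = (∑ j, ∑ e : Fin m → Bool, |∑ i ∈ A j, sg (e i)| ^ q) * S := by
          rw [← Finset.sum_mul, Finset.sum_comm]
      _ ≤ (∑ j, 2 ^ m * (q * 2 ^ (q / 2) * Real.Gamma (q / 2) * (k j : ℝ) ^ (q / 2))) * S := by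
          refine mul_le_mul_of_nonneg_right (Finset.sum_le_sum fun j _ => ?_) hS0
          have := moment (A j) q hq1
          rwa [show (A j).card = k j from hb j] at this
      _ = 2 ^ m * (q * 2 ^ (q / 2) * Real.Gamma (q / 2) * (∑ j, (k j : ℝ) ^ (q / 2)) * S) := by
          rw [← Finset.mul_sum, ← Finset.mul_sum]; ring
      _ ≤ _ := by
          gcongr
          exact sum_rpow_card q m n hm hpm k hsum
  have key2 := le_of_mul_le_mul_left key (by positivity)
  have hf : (0:ℝ) < m.factorial := by positivity
  rw [div_mul_eq_mul_div, le_div_iff₀ hf, mul_comm]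
  exact key2
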